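/- Assume ι is finite and each S i is a finite type. The following are equivalent: (1) distinct least expressive events have distinct top fibers (the top-fiber map is injective on 𝓔'); (2) the cardinality of 𝓔' equals 2^(card (S ⊤)); (3) there exists an order isomorphism from (𝓔', ⊑) onto the set of events with base-space ⊤ (the events (T^↑, ⊤) for nonempty T ⊆ S ⊤ together with the empty event) ordered by ≤, given by sending each least expressive event with top fiber T to the event with base ⊤ determined by T. (This is the paper's Theorem 5.) -/

import Mathlib

/-- The union space of the lattice model: `Ω := Σ i, S i`. For `j : ι` and
`A ⊆ S j`, the upper set `A^↑ ⊆ Ω` consists of the states `⟨i, x⟩` with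
`j ≤ i` whose projection `r _ x` to `S j` lies in `A`. -/
def upSet {ι : Type*} [PartialOrder ι] {S : ι → Type*}
    (r : ∀ ⦃j i : ι⦄, j ≤ i → S i → S j) (j : ι) (A : Set (S j)) :
    Set (Σ i, S i) :=
  {ω | ∃ h : j ≤ ω.1, r h ω.2 ∈ A}

/-- The top fiber of the event `(A^↑, j)`: the preimage `r_{j⊤}⁻¹(A) ⊆ S ⊤`. -/
def topFiber {ι : Type*} [PartialOrder ι] [OrderTop ι] {S : ι → Type*}
    (r : ∀ ⦃j i : ι⦄, j ≤ i → S i → S j) (e : Σ j, Set (S j)) : Set (S (⊤ : ι)) :=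
  r (le_top : e.1 ≤ ⊤) ⁻¹' e.2

/-- The order `≤` on events: `(B^↑, k) ≤ (A^↑, j)` iff `B^↑ ⊆ A^↑` and `j ≤ k`. -/
def eventLE {ι : Type*} [PartialOrder ι] {S : ι → Type*}
    (r : ∀ ⦃j i : ι⦄, j ≤ i → S i → S j) (e' e : Σ j, Set (S j)) : Prop :=
  upSet r e'.1 e'.2 ⊆ upSet r e.1 e.2 ∧ e.1 ≤ e'.1

/-- The order `⊑` on events: inclusion of top fibers. -/
def eventSqle {ι : Type*} [PartialOrder ι] [OrderTop ι] {S : ι → Type*}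
    (r : ∀ ⦃j i : ι⦄, j ≤ i → S i → S j) (e' e : Σ j, Set (S j)) : Prop :=
  topFiber r e' ⊆ topFiber r e

/-- Membership in `𝓔'`, the set of least expressive events: either the
distinguished empty event `(∅, ⊤)`, or an event `(A^↑, j)` (`A` nonempty) such
that no event `(B^↑, k)` with `k ≤ j` and `k ≠ j` has the same top fiber. -/
def LeastExpressive {ι : Type*} [PartialOrder ι] [OrderTop ι] {S : ι → Type*}
    (r : ∀ ⦃j i : ι⦄, j ≤ i → S i → S j) (e : Σ j, Set (S j)) : Prop :=
  (e.1 = ⊤ ∧ e.2 = ∅) ∨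
  (e.2.Nonempty ∧ ∀ (k : ι) (B : Set (S k)), B.Nonempty → k ≤ e.1 → k ≠ e.1 →
    topFiber r ⟨k, B⟩ ≠ topFiber r e)

theorem topFiber_top {ι : Type*} [PartialOrder ι] [OrderTop ι] {S : ι → Type*}
    (r : ∀ ⦃j i : ι⦄, j ≤ i → S i → S j) (hr_id : ∀ (j : ι) (x : S j), r (le_refl j) x = x)
    (T : Set (S (⊤ : ι))) : topFiber r ⟨⊤, T⟩ = T := by
  ext x
  exact iff_of_eq (congrArg (· ∈ T) (hr_id ⊤ x))

theorem eventLE_top_iff {ι : Type*} [PartialOrder ι] [OrderTop ι] {S : ι → Type*}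
    (r : ∀ ⦃j i : ι⦄, j ≤ i → S i → S j) (hr_id : ∀ (j : ι) (x : S j), r (le_refl j) x = x)
    (A B : Set (S (⊤ : ι))) : eventLE r ⟨⊤, A⟩ ⟨⊤, B⟩ ↔ A ⊆ B := by
  refine ⟨fun h x hx => ?_, fun h => ⟨fun ω ⟨hω, hA⟩ => ⟨hω, h hA⟩, le_rfl⟩⟩
  obtain ⟨_, hB⟩ := h.1 (show (⟨⊤, x⟩ : Σ i, S i) ∈ upSet r ⊤ A from
    ⟨le_rfl, (hr_id ⊤ x).symm ▸ hx⟩)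
  exact hr_id ⊤ x ▸ hB

/-- Every subset of the top state-space is the top fiber of a least expressive event. -/
theorem exists_leastExpressive_topFiber_eq {ι : Type*} [PartialOrder ι] [OrderTop ι] [Finite ι]
    {S : ι → Type*} (r : ∀ ⦃j i : ι⦄, j ≤ i → S i → S j)
    (hr_id : ∀ (j : ι) (x : S j), r (le_refl j) x = x) (T : Set (S (⊤ : ι))) :
    ∃ e : Σ j, Set (S j), LeastExpressive r e ∧ topFiber r e = T := by
  rcases T.eq_empty_or_nonempty with rfl | hT
  · exact ⟨⟨⊤, ∅⟩, Or.inl ⟨rfl, rfl⟩, rfl⟩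
  · obtain ⟨j, ⟨A, hA, hAT⟩, hmin⟩ := (wellFounded_lt (α := ι)).has_min
      {j | ∃ A : Set (S j), A.Nonempty ∧ topFiber r ⟨j, A⟩ = T}
      ⟨⊤, T, hT, topFiber_top r hr_id T⟩
    exact ⟨⟨j, A⟩, Or.inr ⟨hA, fun k B hB hk hne h =>
      hmin k ⟨B, hB, h.trans hAT⟩ (lt_of_le_of_ne hk hne)⟩, hAT⟩

/-- Theorem 5 of the paper: for finite `ι` and finite
state-spaces, the following are equivalent: (1) the top-fiber map is injective
on `𝓔'`; (2) `|𝓔'| = 2 ^ |S ⊤|`; (3) sending a least expressive event `e` to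
the event with base `⊤` determined by its top fiber is an order isomorphism
from `(𝓔', ⊑)` onto the events with base-space `⊤` ordered by `≤`. -/
theorem stmt16 {ι : Type*} [PartialOrder ι] [OrderTop ι] [Finite ι] {S : ι → Type*}
    [∀ i, Fintype (S i)]
    (r : ∀ ⦃j i : ι⦄, j ≤ i → S i → S j)
    (hr_id : ∀ (j : ι) (x : S j), r (le_refl j) x = x)
    (hr_comp : ∀ {k j i : ι} (hkj : k ≤ j) (hji : j ≤ i) (x : S i),
      r (hkj.trans hji) x = r hkj (r hji x))
    (hsurj : ∀ ⦃j i : ι⦄ (h : j ≤ i), Function.Surjective (r h)) :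
    List.TFAE
      [ -- (1) distinct least expressive events have distinct top fibers
        ∀ e e' : Σ j, Set (S j), LeastExpressive r e → LeastExpressive r e' →
          topFiber r e = topFiber r e' → e = e',
        -- (2) the cardinality of 𝓔' equals 2 ^ card (S ⊤)
        Nat.card {e : Σ j, Set (S j) // LeastExpressive r e}
          = 2 ^ Fintype.card (S (⊤ : ι)),
        -- (3) e ↦ (base ⊤, top fiber of e) is an order isomorphism from
        -- (𝓔', ⊑) onto the events with base-space ⊤ ordered by ≤
        Set.BijOn (fun e => (⟨⊤, topFiber r e⟩ : Σ j, Set (S j)))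
            {e : Σ j, Set (S j) | LeastExpressive r e}
            {e : Σ j, Set (S j) | e.1 = ⊤} ∧
          ∀ e e' : Σ j, Set (S j), LeastExpressive r e → LeastExpressive r e' →
            (eventSqle r e' e ↔
              eventLE r ⟨⊤, topFiber r e'⟩ ⟨⊤, topFiber r e⟩) ] := by
  let f : {e : Σ j, Set (S j) // LeastExpressive r e} → Set (S (⊤ : ι)) :=
    fun e => topFiber r e.1
  have hsur : Function.Surjective f := fun T => by
    obtain ⟨e, he, h⟩ := exists_leastExpressive_topFiber_eq r hr_id T
    exact ⟨⟨e, he⟩, h⟩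
  have hcard : Nat.card (Set (S (⊤ : ι))) = 2 ^ Fintype.card (S (⊤ : ι)) := by
    rw [Nat.card_eq_fintype_card, Fintype.card_set]
  tfae_have 1 → 2 := fun h => by
    rw [← hcard]
    exact Nat.card_eq_of_bijective f
      ⟨fun a b hab => Subtype.ext (h a.1 b.1 a.2 b.2 hab), hsur⟩
  tfae_have 2 → 1 := fun h e e' he he' hee => by
    have hbij := (Nat.bijective_iff_surjective_and_card f).2 ⟨hsur, h.trans hcard.symm⟩
    exact congrArg Subtype.val (@hbij.1 ⟨e, he⟩ ⟨e', he'⟩ hee)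
  tfae_have 1 → 3 := fun h => by
    refine ⟨⟨fun e _ => rfl, fun e he e' he' hee => h e e' he he' ?_, ?_⟩,
      fun e e' _ _ => (eventLE_top_iff r hr_id _ _).symm⟩
    · exact eq_of_heq (Sigma.mk.inj hee).2
    · rintro ⟨j, T⟩ rfl
      obtain ⟨e, he, h⟩ := exists_leastExpressive_topFiber_eq r hr_id T
      exact ⟨e, he, congrArg (Sigma.mk _) h⟩
  tfae_have 3 → 1 := fun h e e' he he' hee =>
    h.1.injOn he he' (congrArg (Sigma.mk _) hee)
  tfae_finish
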